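/- Let C be a monoidal category and e : C ≌ C a monoidal equivalence with functor α, tensorator η and inverse-counit isomorphism ξ. Then the assignment (X, ψ) ↦ (α(X), ψ^α) on objects and f ↦ α(f) on morphisms defines a monoidal functor from the Drinfeld center Z(C) to itself, with monoidal structure maps given by the tensorator η, and this functor is braided and is an equivalence of categories. -/

import Mathlib

open CategoryTheory MonoidalCategory

universe v u

namespace DrinfeldConj

variable {C : Type u} [Category.{v} C] [MonoidalCategory C]

/-- The conjugated half-braiding `ψ^α_Y := (ξ_Y⁻¹ ⊗ id_{αX}) ∘ η_{α⁻¹Y,X}⁻¹ ∘ α(ψ_{α⁻¹Y})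
∘ η_{X,α⁻¹Y} ∘ (id_{αX} ⊗ ξ_Y)`, where `ξ_Y : Y ≅ α(α⁻¹Y)` is the inverse of the counit
isomorphism of the equivalence and `η` is the tensorator of `α`. -/
noncomputable def conj (α : C ⥤ C) [α.Monoidal] [α.IsEquivalence]
    {X : C} (ψ : ∀ Y : C, X ⊗ Y ≅ Y ⊗ X) (Y : C) :
    α.obj X ⊗ Y ≅ Y ⊗ α.obj X :=
  whiskerLeftIso (α.obj X) (α.asEquivalence.counitIso.app Y).symm ≪≫
    Functor.Monoidal.μIso α X (α.asEquivalence.inverse.obj Y) ≪≫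
    α.mapIso (ψ (α.asEquivalence.inverse.obj Y)) ≪≫
    (Functor.Monoidal.μIso α (α.asEquivalence.inverse.obj Y) X).symm ≪≫
    whiskerRightIso (α.asEquivalence.counitIso.app Y) (α.obj X)

open Functor.LaxMonoidal Functor.OplaxMonoidal

section Families

variable (α : C ⥤ C) [α.EssSurj]

/-- Two natural families `X ⊗ U ⟶ U ⊗ Y` that agree on the image of an essentially surjective
functor are equal. -/
lemma family_eq_of_eq_obj {X Y : C} (p q : ∀ U : C, X ⊗ U ⟶ U ⊗ Y)
    (hp : ∀ {U U' : C} (f : U ⟶ U'), X ◁ f ≫ p U' = p U ≫ f ▷ Y)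
    (hq : ∀ {U U' : C} (f : U ⟶ U'), X ◁ f ≫ q U' = q U ≫ f ▷ Y)
    (h : ∀ V, p (α.obj V) = q (α.obj V)) (U : C) : p U = q U := by
  rw [← cancel_epi (X ◁ (α.objObjPreimageIso U).hom), hp, hq, h]

/-- A morphism commutes with half-braidings as soon as it does so on the image of an essentially
surjective functor. -/
lemma comm_of_comm_obj {X Y : C} (φ : HalfBraiding X) (χ : HalfBraiding Y) (f : X ⟶ Y)
    (h : ∀ V, f ▷ α.obj V ≫ (χ.β (α.obj V)).hom = (φ.β (α.obj V)).hom ≫ α.obj V ◁ f) (U : C) :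
    f ▷ U ≫ (χ.β U).hom = (φ.β U).hom ≫ U ◁ f :=
  family_eq_of_eq_obj α (fun U => f ▷ U ≫ (χ.β U).hom) (fun U => (φ.β U).hom ≫ U ◁ f)
    (fun g => by rw [whisker_exchange_assoc, χ.naturality, Category.assoc])
    (fun g => by rw [φ.naturality_assoc, Category.assoc, whisker_exchange]) h U

/-- A natural family of isomorphisms `X ⊗ U ≅ U ⊗ X` is a half-braiding as soon as it is
monoidal on the image of an essentially surjective functor. -/
lemma monoidal_of_monoidal_obj {X : C} (β : ∀ U : C, X ⊗ U ≅ U ⊗ X)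
    (hβ : ∀ {U U' : C} (f : U ⟶ U'), X ◁ f ≫ (β U').hom = (β U).hom ≫ f ▷ X)
    (h : ∀ V V', (β (α.obj V ⊗ α.obj V')).hom =
      (α_ _ _ _).inv ≫ ((β (α.obj V)).hom ▷ α.obj V') ≫ (α_ _ _ _).hom ≫
        (α.obj V ◁ (β (α.obj V')).hom) ≫ (α_ _ _ _).inv) (U U' : C) :
    (β (U ⊗ U')).hom =
      (α_ _ _ _).inv ≫ ((β U).hom ▷ U') ≫ (α_ _ _ _).hom ≫
        (U ◁ (β U').hom) ≫ (α_ _ _ _).inv := by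
  obtain ⟨V, ⟨a⟩⟩ := Functor.EssSurj.mem_essImage (F := α) U
  obtain ⟨V', ⟨b⟩⟩ := Functor.EssSurj.mem_essImage (F := α) U'
  rw [← cancel_epi (X ◁ (a.hom ⊗ₘ b.hom)), hβ, h]
  symm
  calc
    _ = 𝟙 _ ⊗≫ X ◁ α.obj V ◁ b.hom ⊗≫ (X ◁ a.hom ≫ (β U).hom) ▷ U' ⊗≫
        U ◁ (β U').hom ⊗≫ 𝟙 _ := by
      rw [tensorHom_def']; monoidal
    _ = 𝟙 _ ⊗≫ ((X ⊗ α.obj V) ◁ b.hom ≫ (β (α.obj V)).hom ▷ U') ⊗≫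
        (a.hom ▷ (X ⊗ U') ≫ U ◁ (β U').hom) ⊗≫ 𝟙 _ := by
      rw [hβ]; monoidal
    _ = 𝟙 _ ⊗≫ (β (α.obj V)).hom ▷ α.obj V' ⊗≫ α.obj V ◁ (X ◁ b.hom ≫ (β U').hom) ⊗≫
        a.hom ▷ U' ▷ X ⊗≫ 𝟙 _ := by
      rw [whisker_exchange (β (α.obj V)).hom b.hom, ← whisker_exchange a.hom (β U').hom]; monoidal
    _ = _ := by
      rw [hβ, tensorHom_def']; monoidal

end Families

section Transport

/-- Transport of a half-braiding along an isomorphism. -/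
@[simps]
def transportHalfBraiding {X Y : C} (i : X ≅ Y) (φ : HalfBraiding X) : HalfBraiding Y where
  β U := whiskerRightIso i.symm U ≪≫ φ.β U ≪≫ whiskerLeftIso U i
  monoidal U U' := by
    simp
  naturality f := by
    simp [whisker_exchange_assoc, whisker_exchange, φ.naturality_assoc]

end Transport

section Conj

variable (α : C ⥤ C) [α.Monoidal] [α.IsEquivalence]

/-- The conjugated half-braiding is determined by its values along morphisms out of the image
of `α`. -/
lemma whiskerLeft_conj_hom {X : C} (ψ : HalfBraiding X) {V Y : C} (f : α.obj V ⟶ Y) :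
    α.obj X ◁ f ≫ (conj α ψ.β Y).hom =
      μ α X V ≫ α.map (ψ.β V).hom ≫ δ α V X ≫ f ▷ α.obj X := by
  let i : α.obj (α.asEquivalence.inverse.obj Y) ≅ Y := α.asEquivalence.counitIso.app Y
  have hconj : (conj α ψ.β Y).hom = α.obj X ◁ i.inv ≫ μ α X _ ≫ α.map (ψ.β _).hom ≫
      δ α _ X ≫ i.hom ▷ α.obj X := rfl
  obtain ⟨h, hh⟩ := α.map_surjective (f ≫ i.inv)
  obtain rfl : f = α.map h ≫ i.hom := by simp [hh]
  rw [hconj, ← whiskerLeft_comp_assoc, Category.assoc, Iso.hom_inv_id, Category.comp_id,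
    μ_natural_right_assoc, ← α.map_comp_assoc, ψ.naturality, comp_whiskerRight,
    δ_natural_left_assoc, α.map_comp_assoc]

lemma conj_naturality {X : C} (ψ : HalfBraiding X) {U U' : C} (f : U ⟶ U') :
    α.obj X ◁ f ≫ (conj α ψ.β U').hom = (conj α ψ.β U).hom ≫ f ▷ α.obj X := by
  rw [← cancel_epi (α.obj X ◁ (α.objObjPreimageIso U).hom), ← whiskerLeft_comp_assoc,
    whiskerLeft_conj_hom, ← Category.assoc (α.obj X ◁ _), whiskerLeft_conj_hom]
  simp only [comp_whiskerRight, Category.assoc]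

lemma conj_obj {X : C} (ψ : HalfBraiding X) (V : C) :
    (conj α ψ.β (α.obj V)).hom = μ α X V ≫ α.map (ψ.β V).hom ≫ δ α V X := by
  simpa using whiskerLeft_conj_hom α ψ (𝟙 (α.obj V))

/-- The half-braiding `ψ^α` on `α(X)`. -/
noncomputable def conjHalfBraiding {X : C} (ψ : HalfBraiding X) : HalfBraiding (α.obj X) where
  β := conj α ψ.β
  naturality := conj_naturality α ψ
  monoidal := monoidal_of_monoidal_obj α _ (conj_naturality α ψ) fun V V' => by
    rw [← cancel_mono (μ α V V' ▷ α.obj X), ← conj_naturality]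
    simp only [conj_obj, HalfBraiding.monoidal, Functor.map_comp, Functor.Monoidal.map_associator,
      Functor.Monoidal.map_associator_inv, Functor.Monoidal.map_whiskerLeft,
      Functor.Monoidal.map_whiskerRight, Category.assoc, comp_whiskerRight, whiskerLeft_comp,
      Functor.Monoidal.μ_δ_assoc, Functor.Monoidal.μ_δ, Category.comp_id,
      Functor.Monoidal.whiskerLeft_μ_δ_assoc]

lemma conjHalfBraiding_β_obj {X : C} (ψ : HalfBraiding X) (V : C) :
    ((conjHalfBraiding α ψ).β (α.obj V)).hom = μ α X V ≫ α.map (ψ.β V).hom ≫ δ α V X :=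
  conj_obj α ψ V

/-- `α(g)` commutes with the conjugated half-braidings at `α(V)` if and only if `g` commutes with
the original ones at `V`. -/
lemma map_comm_obj_iff {X Y : C} (φ : HalfBraiding X) (χ : HalfBraiding Y) (g : X ⟶ Y) (V : C) :
    α.map g ▷ α.obj V ≫ ((conjHalfBraiding α χ).β (α.obj V)).hom =
        ((conjHalfBraiding α φ).β (α.obj V)).hom ≫ α.obj V ◁ α.map g ↔
      g ▷ V ≫ (χ.β V).hom = (φ.β V).hom ≫ V ◁ g := by
  rw [conjHalfBraiding_β_obj, conjHalfBraiding_β_obj, Category.assoc, Category.assoc,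
    δ_natural_right, μ_natural_left_assoc, cancel_epi, ← α.map_comp_assoc, ← α.map_comp_assoc,
    cancel_mono, α.map_injective.eq_iff]

/-- The functor `(X, ψ) ↦ (α(X), ψ^α)`, `f ↦ α(f)` on the Drinfeld center. -/
@[simps]
noncomputable def conjFunctor : Center C ⥤ Center C where
  obj Z := ⟨α.obj Z.1, conjHalfBraiding α Z.2⟩
  map {Z W} f :=
    { f := α.map f.f
      comm := comm_of_comm_obj α _ _ _ fun V => (map_comm_obj_iff α Z.2 W.2 f.f V).2 (f.comm V) }
  map_id Z := Center.ext _ _ (α.map_id Z.1)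
  map_comp f g := Center.ext _ _ (α.map_comp f.f g.f)

/-- The unit comparison of `conjFunctor α`. -/
noncomputable def conjFunctorε : 𝟙_ (Center C) ⟶ (conjFunctor α).obj (𝟙_ (Center C)) where
  f := ε α
  comm := comm_of_comm_obj α _ _ _ fun V => by
    change ε α ▷ α.obj V ≫ ((conjHalfBraiding α (𝟙_ (Center C)).2).β (α.obj V)).hom =
      ((λ_ (α.obj V)).hom ≫ (ρ_ (α.obj V)).inv) ≫ α.obj V ◁ ε α
    rw [conjHalfBraiding_β_obj]
    change ε α ▷ α.obj V ≫ μ α (𝟙_ C) V ≫ α.map ((λ_ V).hom ≫ (ρ_ V).inv) ≫ δ α V (𝟙_ C) = _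
    simp only [Functor.map_comp, Functor.Monoidal.map_leftUnitor,
      Functor.Monoidal.map_rightUnitor_inv, Category.assoc, Functor.Monoidal.μ_δ_assoc,
      Functor.Monoidal.μ_δ, Category.comp_id, Functor.Monoidal.whiskerRight_ε_η_assoc]

/-- The tensorator of `conjFunctor α`. -/
noncomputable def conjFunctorμ (Z W : Center C) :
    (conjFunctor α).obj Z ⊗ (conjFunctor α).obj W ⟶ (conjFunctor α).obj (Z ⊗ W) where
  f := μ α Z.1 W.1
  comm := comm_of_comm_obj α _ _ _ fun V => by
    change μ α Z.1 W.1 ▷ α.obj V ≫ ((conjHalfBraiding α (Z ⊗ W).2).β (α.obj V)).hom =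
      ((α_ _ _ _).hom ≫ α.obj Z.1 ◁ ((conjHalfBraiding α W.2).β (α.obj V)).hom ≫
        (α_ _ _ _).inv ≫ ((conjHalfBraiding α Z.2).β (α.obj V)).hom ▷ α.obj W.1 ≫
          (α_ _ _ _).hom) ≫ α.obj V ◁ μ α Z.1 W.1
    simp only [conjHalfBraiding_β_obj]
    change μ α Z.1 W.1 ▷ α.obj V ≫ μ α (Z.1 ⊗ W.1) V ≫ α.map ((α_ _ _ _).hom ≫
      Z.1 ◁ (W.2.β V).hom ≫ (α_ _ _ _).inv ≫ (Z.2.β V).hom ▷ W.1 ≫ (α_ _ _ _).hom) ≫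
        δ α V (Z.1 ⊗ W.1) = _
    simp only [Functor.map_comp, Functor.Monoidal.map_associator,
      Functor.Monoidal.map_associator_inv, Functor.Monoidal.map_whiskerLeft,
      Functor.Monoidal.map_whiskerRight, Category.assoc, comp_whiskerRight, whiskerLeft_comp,
      Functor.Monoidal.μ_δ_assoc, Functor.Monoidal.μ_δ, Category.comp_id,
      Functor.Monoidal.whiskerRight_μ_δ_assoc]

instance : IsIso (conjFunctorε α).f := inferInstanceAs (IsIso (ε α))

instance (Z W : Center C) : IsIso (conjFunctorμ α Z W).f := inferInstanceAs (IsIso (μ α Z.1 W.1))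

noncomputable instance : (conjFunctor α).Monoidal :=
  Functor.CoreMonoidal.toMonoidal
    { εIso := Center.isoMk (conjFunctorε α)
      μIso Z W := Center.isoMk (conjFunctorμ α Z W)
      μIso_hom_natural_left f W := Center.ext _ _ (μ_natural_left α f.f W.1)
      μIso_hom_natural_right Z f := Center.ext _ _ (μ_natural_right α Z.1 f.f)
      associativity X Y Z := Center.ext _ _ (associativity α X.1 Y.1 Z.1)
      left_unitality X := Center.ext _ _ (left_unitality α X.1)
      right_unitality X := Center.ext _ _ (right_unitality α X.1) }

noncomputable instance : (conjFunctor α).Braided where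
  braided Z W := Center.ext _ _ <| by
    change μ α Z.1 W.1 ≫ α.map (Z.2.β W.1).hom =
      ((conjHalfBraiding α Z.2).β (α.obj W.1)).hom ≫ μ α W.1 Z.1
    simp [conjHalfBraiding_β_obj]

/-- The half-braiding on `X` induced by a half-braiding on `α(X)`. -/
noncomputable def preimageHalfBraiding {X : C} (φ : HalfBraiding (α.obj X)) : HalfBraiding X where
  β V := α.preimageIso ((Functor.Monoidal.μIso α X V).symm ≪≫ φ.β (α.obj V) ≪≫
    Functor.Monoidal.μIso α V X)
  monoidal V V' := α.map_injective <| by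
    have h : (φ.β (α.obj (V ⊗ V'))).hom = α.obj X ◁ δ α V V' ≫
        (φ.β (α.obj V ⊗ α.obj V')).hom ≫ μ α V V' ▷ α.obj X := by
      rw [← φ.naturality, Functor.Monoidal.whiskerLeft_δ_μ_assoc]
    rw [φ.monoidal] at h
    simp only [Functor.preimageIso_hom, Functor.map_preimage, Iso.trans_hom, Iso.symm_hom,
      Functor.Monoidal.μIso_hom, Functor.Monoidal.μIso_inv, h,
      Functor.map_comp, Functor.Monoidal.map_associator,
      Functor.Monoidal.map_associator_inv, Functor.Monoidal.map_whiskerLeft,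
      Functor.Monoidal.map_whiskerRight, Category.assoc, comp_whiskerRight, whiskerLeft_comp,
      Functor.Monoidal.μ_δ_assoc, Functor.Monoidal.whiskerLeft_μ_δ_assoc,
      Functor.Monoidal.whiskerRight_μ_δ_assoc]
  naturality f := α.map_injective <| by
    simp only [Functor.preimageIso_hom, Functor.map_preimage, Iso.trans_hom, Iso.symm_hom,
      Functor.Monoidal.μIso_hom, Functor.Monoidal.μIso_inv, Functor.map_comp, Category.assoc]
    rw [← μ_natural_left, ← δ_natural_right_assoc, φ.naturality_assoc]

lemma map_preimageHalfBraiding_β {X : C} (φ : HalfBraiding (α.obj X)) (V : C) :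
    α.map ((preimageHalfBraiding α φ).β V).hom = δ α X V ≫ (φ.β (α.obj V)).hom ≫ μ α V X := by
  simp [preimageHalfBraiding]

instance : (conjFunctor α).Faithful where
  map_injective h := Center.ext _ _ (α.map_injective (congrArg Center.Hom.f h))

instance : (conjFunctor α).Full where
  map_surjective {Z W} f := by
    obtain ⟨g, hg⟩ := α.map_surjective f.f
    exact ⟨⟨g, fun U => (map_comm_obj_iff α Z.2 W.2 g U).1 (by rw [hg]; exact f.comm _)⟩,
      Center.ext _ _ hg⟩

instance : (conjFunctor α).EssSurj where
  mem_essImage Z := by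
    let i := (α.objObjPreimageIso Z.1)
    let φ := transportHalfBraiding i.symm Z.2
    let f : (conjFunctor α).obj ⟨_, preimageHalfBraiding α φ⟩ ⟶ Z :=
      { f := i.hom
        comm := comm_of_comm_obj α _ _ _ fun V => by
          change i.hom ▷ α.obj V ≫ (Z.2.β (α.obj V)).hom =
            ((conjHalfBraiding α (preimageHalfBraiding α φ)).β (α.obj V)).hom ≫ α.obj V ◁ i.hom
          rw [conjHalfBraiding_β_obj, map_preimageHalfBraiding_β]
          simp [φ] }
    have : IsIso f.f := inferInstanceAs (IsIso i.hom)
    exact ⟨_, ⟨Center.isoMk f⟩⟩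

instance : (conjFunctor α).IsEquivalence where

end Conj

/-- the assignment `(X, ψ) ↦ (α(X), ψ^α)`, `f ↦ α(f)` defines a monoidal
functor of the Drinfeld center `Z(C)` to itself whose monoidal structure maps are given by
the tensorator of `α`, and this functor is braided and an equivalence of categories. -/
theorem conj_induced_functor (α : C ⥤ C) [α.Monoidal] [α.IsEquivalence] :
    ∃ (F : Center C ⥤ Center C) (instB : F.Braided),
      letI := instB
      F.IsEquivalence ∧
      (∀ Z : Center C, (F.obj Z).1 = α.obj Z.1) ∧
      (∀ (Z : Center C) (Y : C), HEq ((F.obj Z).2.β Y) (conj α (fun U => Z.2.β U) Y)) ∧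
      (∀ (Z W : Center C) (f : Z ⟶ W), HEq (F.map f).f (α.map f.f)) ∧
      (∀ Z W : Center C,
        HEq (Functor.LaxMonoidal.μ F Z W).f (Functor.LaxMonoidal.μ α Z.1 W.1)) := by
  refine ⟨conjFunctor α, inferInstance, inferInstance, fun _ => rfl, fun _ _ => HEq.rfl,
    fun _ _ _ => HEq.rfl, fun _ _ => HEq.rfl⟩

end DrinfeldConj
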